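/- (Noether's theorem in the sense of Riesz–Caputo without transformation of time.) Let 0 < α < 1, a < b, let L : [a,b] × ℝⁿ × ℝⁿ → ℝ be of class C², let q : [a,b] → ℝⁿ be of class C², and let ξ : [a,b] × ℝⁿ → ℝⁿ be of class C¹. Assume: (i) invariance: for every ε in a neighbourhood of 0 and every subinterval [t_a, t_b] ⊆ [a,b], ∫_{t_a}^{t_b} L(t, q(t), (ᴿᶜDᵅ q)(t)) dt = ∫_{t_a}^{t_b} L(t, q(t)+εξ(t,q(t)), (ᴿᶜDᵅ (q+εξ(·,q)))(t)) dt; (ii) q is a fractional Riesz–Caputo extremal, i.e. ∂₂L(t, q(t), (ᴿᶜDᵅ q)(t)) = (ᴿDᵅ [s ↦ ∂₃L(s, q(s), (ᴿᶜDᵅ q)(s))])(t) for all t ∈ [a,b]. Then the fractional conservation law 𝒟ᵅ(∂₃L(·, q, ᴿᶜDᵅq), ξ(·,q)) = 0 holds; explicitly, for all t ∈ [a,b]: ξ(t, q(t)) · (ᴿDᵅ [s ↦ ∂₃L(s, q(s), (ᴿᶜDᵅ q)(s))])(t) + ∂₃L(t, q(t), (ᴿᶜDᵅ q)(t)) ·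 (ᴿᶜDᵅ [s ↦ ξ(s, q(s))])(t) = 0. -/

import Mathlib

open Real Set MeasureTheory intervalIntegral
open scoped RealInnerProductSpace

/-- Riesz-type kernel integral of `g` on `[a,b]`:
`(1/(2Γ(1-α))) ∫_a^b |s-θ|^{-α} g(θ) dθ`. -/
noncomputable def rieszInt {E : Type*} [NormedAddCommGroup E] [NormedSpace ℝ E]
    (α a b : ℝ) (g : ℝ → E) (s : ℝ) : E :=
  (1 / (2 * Real.Gamma (1 - α))) • ∫ θ in a..b, |s - θ| ^ (-α) • g θ

/-- Riesz–Caputo fractional derivative of order `α` (for `0 < α < 1`) of `f` on `[a,b]`: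
`(1/(2Γ(1-α))) ∫_a^b |t-θ|^{-α} f'(θ) dθ`. -/
noncomputable def RCDeriv {E : Type*} [NormedAddCommGroup E] [NormedSpace ℝ E]
    (α a b : ℝ) (f : ℝ → E) (t : ℝ) : E :=
  rieszInt α a b (fun θ => derivWithin f (Set.Icc a b) θ) t

/-- Riesz fractional derivative of order `α` (for `0 < α < 1`) of `g` on `[a,b]`:
`d/dt [(1/(2Γ(1-α))) ∫_a^b |t-θ|^{-α} g(θ) dθ]`. -/
noncomputable def RDeriv {E : Type*} [NormedAddCommGroup E] [NormedSpace ℝ E]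
    (α a b : ℝ) (g : ℝ → E) (t : ℝ) : E :=
  deriv (rieszInt α a b g) t

open Filter

lemma intervalIntegrable_abs_rpow {r : ℝ} (hr : -1 < r) (c d : ℝ) :
    IntervalIntegrable (fun x : ℝ => |x| ^ r) volume c d := by
  have hpos (e : ℝ) (he : 0 ≤ e) : IntervalIntegrable (fun x : ℝ => |x| ^ r) volume 0 e := by
    refine (intervalIntegrable_rpow' hr).congr fun x hx => ?_
    rw [uIoc_of_le he] at hx
    simp only [abs_of_pos hx.1]
  have hall (e : ℝ) : IntervalIntegrable (fun x : ℝ => |x| ^ r) volume 0 e := by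
    rcases le_total 0 e with he | he
    · exact hpos e he
    · rw [IntervalIntegrable.iff_comp_neg]
      simpa using hpos (-e) (by linarith)
  exact (hall c).symm.trans (hall d)

lemma continuousAt_indicator_Ioc {E : Type*} [NormedAddCommGroup E] {a b : ℝ} {g : ℝ → E}
    (hg : ContinuousOn g (Icc a b)) {x : ℝ} (ha : x ≠ a) (hb : x ≠ b) :
    ContinuousAt ((Ioc a b).indicator g) x := by
  by_cases hx : x ∈ Ioo a b
  · refine (hg.continuousAt (Icc_mem_nhds hx.1 hx.2)).congr ?_
    filter_upwards [Ioo_mem_nhds hx.1 hx.2] with y hy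
    exact (indicator_of_mem (Ioo_subset_Ioc_self hy) g).symm
  · have hx' : x ∉ Icc a b := fun h => hx ⟨h.1.lt_of_ne' ha, h.2.lt_of_ne hb⟩
    refine (continuousAt_const (y := (0 : E))).congr ?_
    filter_upwards [isClosed_Icc.isOpen_compl.mem_nhds hx'] with y hy
    exact (indicator_of_notMem (fun h => hy (Ioc_subset_Icc_self h)) g).symm

section Riesz

variable {E : Type*} [NormedAddCommGroup E] [NormedSpace ℝ E] {α a b : ℝ} {f g : ℝ → E}

lemma intervalIntegrable_rieszKernel_smul (hα : α < 1) (hab : a ≤ b)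
    (hg : ContinuousOn g (Icc a b)) (s : ℝ) :
    IntervalIntegrable (fun θ => |s - θ| ^ (-α) • g θ) volume a b := by
  refine IntervalIntegrable.smul_continuousOn ?_ (by rwa [uIcc_of_le hab])
  simpa using
    (intervalIntegrable_abs_rpow (r := -α) (by linarith) (s - a) (s - b)).comp_sub_left s

lemma rieszInt_add_smul (hα : α < 1) (hab : a ≤ b) (hf : ContinuousOn f (Icc a b))
    (hg : ContinuousOn g (Icc a b)) (ε s : ℝ) :
    rieszInt α a b (fun θ => f θ + ε • g θ) s
      = rieszInt α a b f s + ε • rieszInt α a b g s := by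
  have hadd := intervalIntegral.integral_add (intervalIntegrable_rieszKernel_smul hα hab hf s)
    ((intervalIntegrable_rieszKernel_smul hα hab hg s).smul ε)
  simp only [Pi.smul_apply, intervalIntegral.integral_smul] at hadd
  simp only [rieszInt, smul_add, smul_comm _ ε, hadd]

lemma continuous_rieszInt (hα : α < 1) (hab : a ≤ b) (hg : ContinuousOn g (Icc a b)) :
    Continuous (rieszInt α a b g) := by
  set G : ℝ → E := (Ioc a b).indicator g with hG
  obtain ⟨C, hC⟩ := isCompact_Icc.exists_bound_of_continuousOn hg
  have hconv (s : ℝ) :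
      ∫ θ in a..b, |s - θ| ^ (-α) • g θ = ∫ r, |r| ^ (-α) • G (s - r) := by
    rw [← integral_sub_left_eq_self (fun r : ℝ => |r| ^ (-α) • G (s - r)) volume s,
      intervalIntegral.integral_of_le hab, ← MeasureTheory.integral_indicator measurableSet_Ioc]
    simp only [sub_sub_cancel, hG, indicator_smul]
  have hGmeas : AEStronglyMeasurable G volume :=
    (aestronglyMeasurable_indicator_iff measurableSet_Ioc).2
      ((hg.mono Ioc_subset_Icc_self).aestronglyMeasurable measurableSet_Ioc)
  refine Continuous.const_smul (continuous_iff_continuousAt.2 fun s₀ => ?_) _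
  simp only [hconv]
  refine MeasureTheory.continuousAt_of_dominated
    (bound := (Ioc (s₀ - 1 - b) (s₀ + 1 - a)).indicator fun r => |r| ^ (-α) * C) ?_ ?_ ?_ ?_
  · refine Eventually.of_forall fun s => AEStronglyMeasurable.smul ?_ ?_
    · exact (by fun_prop : Measurable fun r : ℝ => |r| ^ (-α)).aestronglyMeasurable
    · exact hGmeas.comp_quasiMeasurePreserving (quasiMeasurePreserving_sub_left volume s)
  · filter_upwards [Ioo_mem_nhds (sub_one_lt s₀) (lt_add_one s₀)] with s hs
    refine Eventually.of_forall fun r => ?_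
    by_cases hr : s - r ∈ Ioc a b
    · have hr' : r ∈ Ioc (s₀ - 1 - b) (s₀ + 1 - a) :=
        ⟨by linarith [hr.2, hs.1], by linarith [hr.1, hs.2]⟩
      rw [indicator_of_mem hr', hG, indicator_of_mem hr, norm_smul,
        Real.norm_of_nonneg (by positivity)]
      gcongr
      exact hC _ (Ioc_subset_Icc_self hr)
    · rw [hG, indicator_of_notMem hr, smul_zero, norm_zero]
      refine indicator_nonneg (fun x _ => mul_nonneg (by positivity) ?_) r
      exact (norm_nonneg _).trans (hC a (left_mem_Icc.2 hab))
  · rw [integrable_indicator_iff measurableSet_Ioc]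
    exact ((intervalIntegrable_abs_rpow (by linarith) _ _).mul_const C).1
  · have hne (c : ℝ) : ∀ᵐ r : ℝ, r ≠ c := by simp [ae_iff]
    filter_upwards [hne (s₀ - a), hne (s₀ - b)] with r hra hrb
    refine ContinuousAt.const_smul ?_ _
    refine ContinuousAt.comp (f := fun s : ℝ => s - r) (g := G)
      (continuousAt_indicator_Ioc hg ?_ ?_) (by fun_prop)
    · intro h; apply hra; linarith
    · intro h; apply hrb; linarith

lemma continuous_RCDeriv (hα : α < 1) (hab : a < b) (hf : ContDiffOn ℝ 1 f (Icc a b)) :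
    Continuous (RCDeriv α a b f) :=
  continuous_rieszInt hα hab.le (hf.continuousOn_derivWithin (uniqueDiffOn_Icc hab) le_rfl)

lemma RCDeriv_add_smul (hα : α < 1) (hab : a < b) (hf : ContDiffOn ℝ 1 f (Icc a b))
    (hg : ContDiffOn ℝ 1 g (Icc a b)) (ε t : ℝ) :
    RCDeriv α a b (fun s => f s + ε • g s) t
      = RCDeriv α a b f t + ε • RCDeriv α a b g t := by
  have hu := uniqueDiffOn_Icc hab
  unfold RCDeriv
  rw [← rieszInt_add_smul hα hab.le (hf.continuousOn_derivWithin hu le_rfl)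
    (hg.continuousOn_derivWithin hu le_rfl)]
  simp only [rieszInt]
  congr 1
  refine intervalIntegral.integral_congr fun θ hθ => ?_
  rw [uIcc_of_le hab.le] at hθ
  have hdf := (hf.differentiableOn one_ne_zero θ hθ).hasDerivWithinAt
  have hdg := (hg.differentiableOn one_ne_zero θ hθ).hasDerivWithinAt
  have hd := (hdf.add (hdg.const_smul ε)).derivWithin (hu θ hθ)
  exact congrArg _ hd

end Riesz

/-- Two continuous functions with the same integrals over all subintervals coincide. -/
lemma eqOn_Icc_of_integral_eq {a b : ℝ} (hab : a < b) {f g : ℝ → ℝ}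
    (hf : ContinuousOn f (Icc a b)) (hg : ContinuousOn g (Icc a b))
    (h : ∀ x ∈ Icc a b, ∫ t in a..x, f t = ∫ t in a..x, g t) : EqOn f g (Icc a b) := by
  intro x hx
  have : Fact (x ∈ Icc a b) := ⟨hx⟩
  have key {k : ℝ → ℝ} (hk : ContinuousOn k (Icc a b)) :
      HasDerivWithinAt (fun u => ∫ t in a..u, k t) (k x) (Icc a b) x :=
    intervalIntegral.integral_hasDerivWithinAt_right
      ((hk.mono (Icc_subset_Icc_right hx.2)).intervalIntegrable_of_Icc hx.1)
      (hk.stronglyMeasurableAtFilter_nhdsWithin measurableSet_Icc x) (hk x hx)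
  exact (uniqueDiffOn_Icc hab x hx).eq_deriv _ (key hf) ((key hg).congr h (h x hx))

/-- The derivative at `0` of `ε ↦ F (y + ε η, v + ε ζ)`, in terms of the partial gradients. -/
lemma hasDerivAt_zero_of_partial_gradients {E : Type*} [NormedAddCommGroup E]
    [InnerProductSpace ℝ E] [CompleteSpace E] {F : E → E → ℝ} {y v : E}
    (hF : DifferentiableAt ℝ (fun p : E × E => F p.1 p.2) (y, v)) (η ζ : E) :
    HasDerivAt (fun ε : ℝ => F (y + ε • η) (v + ε • ζ))
      (⟪η, gradient (fun z => F z v) y⟫ + ⟪gradient (fun z => F y z) v, ζ⟫) 0 := by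
  set D := fderiv ℝ (fun p : E × E => F p.1 p.2) (y, v) with hD
  have hFD : HasFDerivAt (fun p : E × E => F p.1 p.2) D (y, v) := hF.hasFDerivAt
  have hleft : fderiv ℝ (fun z => F z v) y = D.comp (ContinuousLinearMap.inl ℝ E E) :=
    (HasFDerivAt.comp (g := fun p : E × E => F p.1 p.2) (f := fun z => (z, v)) y hFD
      (hasFDerivAt_prodMk_left y v)).fderiv
  have hright : fderiv ℝ (fun z => F y z) v = D.comp (ContinuousLinearMap.inr ℝ E E) :=
    (HasFDerivAt.comp (g := fun p : E × E => F p.1 p.2) (f := fun z => (y, z)) v hFD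
      (hasFDerivAt_prodMk_right y v)).fderiv
  have hline (z w : E) : HasDerivAt (fun ε : ℝ => z + ε • w) w 0 := by
    simpa using ((hasDerivAt_id (0 : ℝ)).smul_const w).const_add z
  have hpath := (hline y η).prodMk (hline v ζ)
  have hcomp := HasFDerivAt.comp_hasDerivAt (l := fun p : E × E => F p.1 p.2) (l' := D) 0
    (by simpa using hFD) hpath
  have hval : ⟪η, gradient (fun z => F z v) y⟫ + ⟪gradient (fun z => F y z) v, ζ⟫
      = D (η, ζ) := by
    rw [real_inner_comm, inner_gradient_left, inner_gradient_left, hleft, hright]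
    simp [← map_add]
  rw [hval]
  exact hcomp

/-- (Noether's theorem in the sense of Riesz–Caputo without
transformation of time.)  If the functional `I[q] = ∫_a^b L(t,q(t),(ᴿᶜDᵅq)(t)) dt` is
invariant under `q̄_ε(t) = q(t) + ε ξ(t,q(t))` and `q` is a fractional Riesz–Caputo
extremal, then the fractional conservation law
`𝒟ᵅ(∂₃L(·,q,ᴿᶜDᵅq), ξ(·,q)) = 0` holds on `[a,b]`. -/
theorem fractional_noether_without_time_transformation
    {n : ℕ} (α a b : ℝ) (hα0 : 0 < α) (hα1 : α < 1) (hab : a < b)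
    (L : ℝ → EuclideanSpace ℝ (Fin n) → EuclideanSpace ℝ (Fin n) → ℝ)
    (hL : ContDiff ℝ 2 (fun x : ℝ × EuclideanSpace ℝ (Fin n) × EuclideanSpace ℝ (Fin n) =>
      L x.1 x.2.1 x.2.2))
    (q : ℝ → EuclideanSpace ℝ (Fin n)) (hq : ContDiffOn ℝ 2 q (Set.Icc a b))
    (ξ : ℝ → EuclideanSpace ℝ (Fin n) → EuclideanSpace ℝ (Fin n))
    (hξ : ContDiff ℝ 1 (fun x : ℝ × EuclideanSpace ℝ (Fin n) => ξ x.1 x.2))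
    -- (i) invariance without transformation of the independent variable:
    (hinv : ∃ δ > (0:ℝ), ∀ ε : ℝ, |ε| < δ →
      ∀ ta tb : ℝ, a ≤ ta → ta ≤ tb → tb ≤ b →
        ∫ t in ta..tb, L t (q t) (RCDeriv α a b q t)
          = ∫ t in ta..tb, L t (q t + ε • ξ t (q t))
              (RCDeriv α a b (fun s => q s + ε • ξ s (q s)) t))
    -- (ii) `q` is a fractional Riesz–Caputo extremal:
    (hext : ∀ t ∈ Set.Icc a b,
      gradient (fun y => L t y (RCDeriv α a b q t)) (q t)
        = RDeriv α a b (fun s => gradient (fun v => L s (q s) v) (RCDeriv α a b q s)) t) :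
    ∀ t ∈ Set.Icc a b,
      ⟪ξ t (q t),
          RDeriv α a b (fun s => gradient (fun v => L s (q s) v) (RCDeriv α a b q s)) t⟫
        + ⟪gradient (fun v => L t (q t) v) (RCDeriv α a b q t),
            RCDeriv α a b (fun s => ξ s (q s)) t⟫ = 0 := by
  intro t ht
  have hq1 : ContDiffOn ℝ 1 q (Icc a b) := hq.of_le one_le_two
  have hξq : ContDiffOn ℝ 1 (fun s => ξ s (q s)) (Icc a b) :=
    hξ.comp_contDiffOn (contDiffOn_id.prodMk hq1)
  obtain ⟨δ, hδ, hinv⟩ := hinv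
  have hconst (ε : ℝ) (hε : |ε| < δ) :
      L t (q t) (RCDeriv α a b q t) = L t (q t + ε • ξ t (q t))
        (RCDeriv α a b q t + ε • RCDeriv α a b (fun s => ξ s (q s)) t) := by
    have hqε : ContDiffOn ℝ 1 (fun s => q s + ε • ξ s (q s)) (Icc a b) :=
      hq1.add (hξq.const_smul ε)
    have hcont {p : ℝ → EuclideanSpace ℝ (Fin n)} (hp : ContDiffOn ℝ 1 p (Icc a b)) :
        ContinuousOn (fun s => L s (p s) (RCDeriv α a b p s)) (Icc a b) :=
      hL.continuous.comp_continuousOn (continuousOn_id.prodMk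
        (hp.continuousOn.prodMk (continuous_RCDeriv hα1 hab hp).continuousOn))
    rw [← RCDeriv_add_smul hα1 hab hq1 hξq ε t]
    exact eqOn_Icc_of_integral_eq hab (hcont hq1) (hcont hqε)
      (fun x hx => hinv ε hε a x le_rfl hx.1 hx.2) ht
  have hLt : DifferentiableAt ℝ
      (fun p : EuclideanSpace ℝ (Fin n) × EuclideanSpace ℝ (Fin n) => L t p.1 p.2)
      (q t, RCDeriv α a b q t) :=
    ((hL.differentiable two_ne_zero).comp
      ((differentiable_const t).prodMk differentiable_id)).differentiableAt
  rw [← hext t ht]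
  refine (hasDerivAt_zero_of_partial_gradients hLt (ξ t (q t))
    (RCDeriv α a b (fun s => ξ s (q s)) t)).unique ?_
  refine (hasDerivAt_const (0 : ℝ) (L t (q t) (RCDeriv α a b q t))).congr_of_eventuallyEq ?_
  filter_upwards [Metric.ball_mem_nhds (0 : ℝ) hδ] with ε hε
  exact (hconst ε (by simpa using hε)).symm
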